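/- Global error representation for a first-order linear recurrence: if e₀,…,e_n satisfy ∑_{j=0}^{m} a_j e_{r+j} = g_r for r = 0,…,n-m, where (a_j) has a_m ≠ 0 and reflected coefficients α_j = a_{m-j}, then for each m ≤ k ≤ n, e_k = ∑_{s=0}^{k-m} α^{(-1)}_{k-m-s} ( g_s - ∑_{i=s-m}^{-1} α_{s-i} e_{i+m} ) where the inner sum involves only starting values e₀,…,e_{m-1}, and (α^{(-1)}_n) is the convolution inverse of (α_n). In particular, if the method is nullstable (so (α^{(-1)}_n) is bounded by some constant K), then |e_k| ≤ K ∑_{s=0}^{k-m} |g_s| + C·max_{0≤r≤m-1} |e_r| with C depending only on m, K, and max_j |α_j|. -/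

import Mathlib

/-- Convolution with `b` undoes convolution with `c` when `b` is the convolution inverse of `c`. -/
theorem sum_range_convInverse_mul {R : Type*} [CommRing R] (c b f : ℕ → R)
    (h : ∀ r : ℕ, ∑ s ∈ Finset.range (r + 1), c (r - s) * b s = if r = 0 then 1 else 0) (N : ℕ) :
    ∑ s ∈ Finset.range (N + 1), b (N - s) * ∑ t ∈ Finset.range (s + 1), c (s - t) * f t = f N := by
  have coeff_mk_mul (u v : ℕ → R) (n : ℕ) :
      PowerSeries.coeff n (PowerSeries.mk u * PowerSeries.mk v) =
        ∑ s ∈ Finset.range (n + 1), u (n - s) * v s := by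
    rw [mul_comm, PowerSeries.coeff_mul, Finset.Nat.sum_antidiagonal_eq_sum_range_succ_mk]
    simp [mul_comm]
  have hinv : PowerSeries.mk c * PowerSeries.mk b = 1 := by
    ext r
    rw [coeff_mk_mul, h, PowerSeries.coeff_one]
  have hmk : PowerSeries.mk (fun s => ∑ t ∈ Finset.range (s + 1), c (s - t) * f t) =
      PowerSeries.mk c * PowerSeries.mk f := by
    ext s
    rw [coeff_mk_mul, PowerSeries.coeff_mk]
  rw [← coeff_mk_mul b (fun s => ∑ t ∈ Finset.range (s + 1), c (s - t) * f t), hmk, ← mul_assoc,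
    mul_comm (PowerSeries.mk b), hinv, one_mul, PowerSeries.coeff_mk]

/-- Splitting the recurrence at index `s` into the starting values `e j`, `j < m`, and a
convolution of the reflected coefficients with the remaining values. -/
theorem sum_recurrence_eq_start_add_conv {R : Type*} [CommRing R] (m : ℕ) (a α e : ℕ → R)
    (hα : ∀ j : ℕ, α j = if j ≤ m then a (m - j) else 0) (s : ℕ) :
    ∑ j ∈ Finset.range (m + 1), a j * e (s + j) =
      ∑ j ∈ Finset.Ico s m, α (m + s - j) * e j +
        ∑ t ∈ Finset.range (s + 1), α (s - t) * e (m + t) := by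
  have hleft : ∑ j ∈ Finset.range (m + 1), a j * e (s + j) =
      ∑ j ∈ Finset.range (m + s + 1), α (m + s - j) * e j := by
    rw [show m + s + 1 = s + (m + 1) by ring, Finset.sum_range_add _ s (m + 1),
      Finset.sum_eq_zero (s := Finset.range s), zero_add]
    · refine Finset.sum_congr rfl fun j hj => ?_
      rw [Finset.mem_range] at hj
      rw [hα, if_pos (by omega), show m - (m + s - (s + j)) = j by omega]
    · intro j hj
      rw [Finset.mem_range] at hj
      rw [hα, if_neg (by omega), zero_mul]
  have hstart : ∑ j ∈ Finset.Ico s m, α (m + s - j) * e j =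
      ∑ j ∈ Finset.range m, α (m + s - j) * e j := by
    refine Finset.sum_subset (fun j hj => ?_) fun j hj hj' => ?_
    · simp only [Finset.mem_Ico, Finset.mem_range] at hj ⊢
      exact hj.2
    · simp only [Finset.mem_Ico, Finset.mem_range] at hj hj'
      rw [hα, if_neg (by omega), zero_mul]
  rw [hleft, hstart, add_assoc m s 1, Finset.sum_range_add]
  simp only [Nat.add_sub_add_left]

/-- The contribution of starting values bounded by `S` is at most `m ^ 2 * M * S`. -/
theorem sum_abs_start_le (m : ℕ) (α e : ℕ → ℝ) {M S : ℝ} (hM : ∀ j, |α j| ≤ M)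
    (hS : 0 ≤ S) (he : ∀ j < m, |e j| ≤ S) (N : ℕ) :
    ∑ s ∈ Finset.range N, |∑ j ∈ Finset.Ico s m, α (m + s - j) * e j| ≤ m ^ 2 * M * S := by
  have hM0 : 0 ≤ M := (abs_nonneg _).trans (hM 0)
  have hterm (s : ℕ) : |∑ j ∈ Finset.Ico s m, α (m + s - j) * e j| ≤
      if s < m then m * (M * S) else 0 := by
    split_ifs with hs
    · calc |∑ j ∈ Finset.Ico s m, α (m + s - j) * e j|
          ≤ ∑ j ∈ Finset.Ico s m, |α (m + s - j) * e j| := Finset.abs_sum_le_sum_abs _ _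
        _ ≤ ∑ j ∈ Finset.Ico s m, M * S := by
            refine Finset.sum_le_sum fun j hj => ?_
            rw [abs_mul]
            exact mul_le_mul (hM _) (he j (Finset.mem_Ico.mp hj).2) (abs_nonneg _) hM0
        _ = ((m - s : ℕ) : ℝ) * (M * S) := by simp
        _ ≤ m * (M * S) := by
            gcongr
            exact Nat.sub_le m s
    · simp [Finset.Ico_eq_empty_of_le (not_lt.mp hs)]
  calc ∑ s ∈ Finset.range N, |∑ j ∈ Finset.Ico s m, α (m + s - j) * e j|
      ≤ ∑ s ∈ Finset.range N, if s < m then m * (M * S) else 0 :=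
        Finset.sum_le_sum fun s _ => hterm s
    _ = ∑ s ∈ Finset.range N with s < m, m * (M * S) := (Finset.sum_filter _ _).symm
    _ ≤ ∑ s ∈ Finset.range m, m * (M * S) := by
        refine Finset.sum_le_sum_of_subset_of_nonneg (fun s hs => ?_) fun _ _ _ => by positivity
        exact Finset.mem_range.mpr (Finset.mem_filter.mp hs).2
    _ = m ^ 2 * M * S := by
        simp only [Finset.sum_const, Finset.card_range, nsmul_eq_mul]
        ring

/-- Global error representation for the linear recurrence `∑ aⱼ e_{r+j} = g_r`
in terms of the convolution inverse of the reflected coefficients, and the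
resulting stability bound in the nullstable (bounded-inverse) case. -/
theorem global_error_representation
    (m : ℕ) (hm : 0 < m) (a : ℕ → ℝ) (ham : a m ≠ 0)
    (α αinv : ℕ → ℝ)
    (hα : ∀ j : ℕ, α j = if j ≤ m then a (m - j) else 0)
    (hconv : ∀ r : ℕ, ∑ s ∈ Finset.range (r + 1), α (r - s) * αinv s =
      if r = 0 then 1 else 0) :
    (∀ (e g : ℕ → ℝ) (n : ℕ),
      (∀ r : ℕ, r ≤ n - m → ∑ j ∈ Finset.range (m + 1), a j * e (r + j) = g r) →
      ∀ k : ℕ, m ≤ k → k ≤ n →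
        e k = ∑ s ∈ Finset.range (k - m + 1), αinv (k - m - s) *
          (g s - ∑ j ∈ Finset.Ico s m, α (m + s - j) * e j)) ∧
    (∀ K M : ℝ, (∀ i : ℕ, |αinv i| ≤ K) → (∀ j : ℕ, j ≤ m → |a j| ≤ M) →
      ∀ (e g : ℕ → ℝ) (n : ℕ),
        (∀ r : ℕ, r ≤ n - m → ∑ j ∈ Finset.range (m + 1), a j * e (r + j) = g r) →
        ∀ k : ℕ, m ≤ k → k ≤ n →
          |e k| ≤ K * ∑ s ∈ Finset.range (k - m + 1), |g s| +
            (K * m ^ 2 * M) *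
              (Finset.range m).sup' (by simp [Finset.nonempty_range_iff, hm.ne']) 
                (fun r => |e r|)) := by
  have hrep : ∀ (e g : ℕ → ℝ) (n : ℕ),
      (∀ r : ℕ, r ≤ n - m → ∑ j ∈ Finset.range (m + 1), a j * e (r + j) = g r) →
      ∀ k : ℕ, m ≤ k → k ≤ n →
        e k = ∑ s ∈ Finset.range (k - m + 1), αinv (k - m - s) *
          (g s - ∑ j ∈ Finset.Ico s m, α (m + s - j) * e j) := by
    intro e g n hrec k hmk hkn
    have hinv := sum_range_convInverse_mul α αinv (fun t => e (m + t)) hconv (k - m)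
    simp only [Nat.add_sub_cancel' hmk] at hinv
    rw [← hinv]
    refine Finset.sum_congr rfl fun s hs => ?_
    rw [Finset.mem_range] at hs
    rw [← hrec s (by omega), sum_recurrence_eq_start_add_conv m a α e hα s, add_sub_cancel_left]
  refine ⟨hrep, fun K M hK hM e g n hrec k hmk hkn => ?_⟩
  have hK0 : 0 ≤ K := (abs_nonneg _).trans (hK 0)
  have hM0 : 0 ≤ M := (abs_nonneg _).trans (hM 0 (Nat.zero_le m))
  have hαM (j : ℕ) : |α j| ≤ M := by
    rw [hα]
    split_ifs
    · exact hM _ (Nat.sub_le m j)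
    · simpa using hM0
  set S := (Finset.range m).sup' (by simp [Finset.nonempty_range_iff, hm.ne']) (fun r => |e r|)
  have heS (j : ℕ) (hj : j < m) : |e j| ≤ S :=
    Finset.le_sup' (fun r => |e r|) (Finset.mem_range.mpr hj)
  have hstart := sum_abs_start_le m α e hαM ((abs_nonneg _).trans (heS 0 hm)) heS (k - m + 1)
  calc |e k| = |∑ s ∈ Finset.range (k - m + 1), αinv (k - m - s) *
          (g s - ∑ j ∈ Finset.Ico s m, α (m + s - j) * e j)| :=
        congrArg _ (hrep e g n hrec k hmk hkn)
    _ ≤ ∑ s ∈ Finset.range (k - m + 1), |αinv (k - m - s) *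
          (g s - ∑ j ∈ Finset.Ico s m, α (m + s - j) * e j)| := Finset.abs_sum_le_sum_abs _ _
    _ ≤ ∑ s ∈ Finset.range (k - m + 1),
          K * (|g s| + |∑ j ∈ Finset.Ico s m, α (m + s - j) * e j|) := by
        refine Finset.sum_le_sum fun s _ => ?_
        rw [abs_mul]
        exact mul_le_mul (hK _) (abs_sub _ _) (abs_nonneg _) hK0
    _ = K * ∑ s ∈ Finset.range (k - m + 1), |g s| +
          K * ∑ s ∈ Finset.range (k - m + 1), |∑ j ∈ Finset.Ico s m, α (m + s - j) * e j| := by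
        rw [← Finset.mul_sum, Finset.sum_add_distrib, mul_add]
    _ ≤ K * ∑ s ∈ Finset.range (k - m + 1), |g s| + K * (m ^ 2 * M * S) := by gcongr
    _ = K * ∑ s ∈ Finset.range (k - m + 1), |g s| + K * m ^ 2 * M * S := by ring
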